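/- Fix k ∈ N and let P, Q ⊂ R^n be lattice polytopes in the class Q_k. If dim(conv(P ∪ Q)) ≥ 2^{k+1}, then the normalized volume Vol(conv(P ∪ Q)) is even. -/

import Mathlib

open Pointwise MeasureTheory

noncomputable section

/-- Standard dot product on `Fin n → ℝ`. -/
def dotR {n : ℕ} (c x : Fin n → ℝ) : ℝ := ∑ i, c i * x i

/-- The set of minimizers of the linear functional `x ↦ cᵀx` over `P`. -/
def argminSet {n : ℕ} (c : Fin n → ℝ) (P : Set (Fin n → ℝ)) : Set (Fin n → ℝ) :=
  {x ∈ P | ∀ y ∈ P, dotR c x ≤ dotR c y}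

/-- A polytope: the convex hull of a nonempty finite set of points. -/
def IsPolytope {n : ℕ} (P : Set (Fin n → ℝ)) : Prop :=
  ∃ V : Finset (Fin n → ℝ), V.Nonempty ∧ P = convexHull ℝ (V : Set (Fin n → ℝ))

/-- A lattice polytope: the convex hull of a nonempty finite set of integral points. -/
def IsLatticePolytope {n : ℕ} (P : Set (Fin n → ℝ)) : Prop :=
  ∃ V : Finset (Fin n → ℤ), V.Nonempty ∧
    P = convexHull ℝ ((fun v (i : Fin n) => ((v i : ℤ) : ℝ)) '' (V : Set (Fin n → ℤ)))

/-- `F` is a face of `P`: either the empty face or the set of minimizers of a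
linear functional over `P`. -/
def IsFace {n : ℕ} (P F : Set (Fin n → ℝ)) : Prop :=
  F = ∅ ∨ ∃ c : Fin n → ℝ, F = argminSet c P

/-- The dimension of a set: the rank of the direction space of its affine span. -/
def polyDim {n : ℕ} (P : Set (Fin n → ℝ)) : ℕ :=
  Module.finrank ℝ (affineSpan ℝ P).direction

/-- A point all of whose coordinates are integers. -/
def IsIntPt {m : ℕ} (x : Fin m → ℝ) : Prop := ∀ i, ∃ z : ℤ, x i = (z : ℝ)

/-- An affine chart identifying the affine hull of `P` with `ℝ^r` and mapping the induced
lattice of integral points bijectively onto `ℤ^r`. -/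
def IsLatticeChart {n r : ℕ} (P : Set (Fin n → ℝ))
    (φ : (Fin n → ℝ) →ᵃ[ℝ] (Fin r → ℝ)) : Prop :=
  Set.BijOn (fun x => φ x) (affineSpan ℝ P : Set (Fin n → ℝ)) Set.univ ∧
  ∀ x ∈ affineSpan ℝ P, (IsIntPt x ↔ IsIntPt (φ x))

open Classical in
/-- The normalized volume of a (rational) polytope `P`: `r!` times the Euclidean volume of
the image of `P` under a lattice-preserving affine chart of its affine hull (`r = dim P`).
This is well defined (independent of the chart) and integral for lattice polytopes. -/
def normVol {n : ℕ} (P : Set (Fin n → ℝ)) : ℝ :=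
  (Nat.factorial (polyDim P)) *
    (if h : ∃ φ : (Fin n → ℝ) →ᵃ[ℝ] (Fin (polyDim P) → ℝ), IsLatticeChart P φ
      then (volume ((fun x => h.choose x) '' P)).toReal
      else 0)

/-- The normalized volume is an even integer. -/
def EvenVol {n : ℕ} (P : Set (Fin n → ℝ)) : Prop := ∃ m : ℤ, normVol P = 2 * (m : ℝ)

/-- The class `Q_k`: lattice polytopes all of whose faces of dimension at least `2^k`
have even normalized volume. -/
def InQclass (k : ℕ) {n : ℕ} (P : Set (Fin n → ℝ)) : Prop :=
  IsLatticePolytope P ∧ ∀ F, IsFace P F → 2 ^ k ≤ polyDim F → EvenVol F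

/-- The classes `P_k` of lattice polytopes dual to `k`-hidden-layer integral ReLU networks:
`P_0` consists of single lattice points, and `P_{k+1}` consists of finite Minkowski sums of
convex hulls of unions of pairs of polytopes from `P_k`. -/
def InPclass {n : ℕ} : ℕ → Set (Fin n → ℝ) → Prop
  | 0, P => ∃ v : Fin n → ℤ, P = {fun i => ((v i : ℤ) : ℝ)}
  | k+1, P => ∃ (l : ℕ) (Q : Fin l → Set (Fin n → ℝ)), 0 < l ∧
      (∀ i, ∃ Q₁ Q₂ : Set (Fin n → ℝ), InPclass k Q₁ ∧ InPclass k Q₂ ∧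
        Q i = convexHull ℝ (Q₁ ∪ Q₂)) ∧
      P = ∑ i, Q i

/-- A (polyhedral) subdivision of `R`: a finite collection of polytopes covering `R`,
any two of which intersect in a common face. -/
def IsSubdivision {n : ℕ} (R : Set (Fin n → ℝ)) (𝒞 : Finset (Set (Fin n → ℝ))) : Prop :=
  (∀ C ∈ 𝒞, IsPolytope C) ∧
  (⋃ C ∈ 𝒞, C) = R ∧
  ∀ C ∈ 𝒞, ∀ D ∈ 𝒞, IsFace C (C ∩ D) ∧ IsFace D (C ∩ D)

/-- The standard simplex `Δ^n_0 = conv{0, e_1, …, e_n} ⊆ ℝ^n`. -/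
def stdSimplexPoly (n : ℕ) : Set (Fin n → ℝ) :=
  convexHull ℝ ({0} ∪ Set.range (fun i : Fin n => fun j => if j = i then (1 : ℝ) else 0))


theorem dotR_add_right {n : ℕ} (c x y : Fin n → ℝ) : dotR c (x + y) = dotR c x + dotR c y := by
  simp [dotR, mul_add, Finset.sum_add_distrib]

theorem dotR_smul_right {n : ℕ} (c x : Fin n → ℝ) (r : ℝ) : dotR c (r • x) = r * dotR c x := by
  simp only [dotR, Finset.mul_sum, Pi.smul_apply, smul_eq_mul]
  exact Finset.sum_congr rfl fun i _ => by ring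

theorem dotR_comm' {n : ℕ} (c x : Fin n → ℝ) : dotR c x = dotR x c := by
  simp [dotR, mul_comm]

theorem dotR_add_left {n : ℕ} (c x y : Fin n → ℝ) : dotR (x + y) c = dotR x c + dotR y c := by
  simp only [dotR_comm' _ c, dotR_add_right]

theorem dotR_smul_left {n : ℕ} (c x : Fin n → ℝ) (r : ℝ) : dotR (r • x) c = r * dotR x c := by
  simp only [dotR_comm' _ c, dotR_smul_right]

/-- `dotR c` as a linear map. -/
def dotL {n : ℕ} (c : Fin n → ℝ) : (Fin n → ℝ) →ₗ[ℝ] ℝ where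
  toFun := dotR c
  map_add' := dotR_add_right c
  map_smul' r x := by simp [dotR_smul_right]

@[simp] theorem dotL_apply {n : ℕ} (c x : Fin n → ℝ) : dotL c x = dotR c x := rfl

theorem dotR_sub_right {n : ℕ} (c x y : Fin n → ℝ) : dotR c (x - y) = dotR c x - dotR c y := by
  simpa using (dotL c).map_sub x y

theorem exists_dotR {n : ℕ} (f : (Fin n → ℝ) →ₗ[ℝ] ℝ) : ∃ c, ∀ x, f x = dotR c x := by
  refine ⟨fun i => f (Pi.single i 1), fun x => ?_⟩
  conv_lhs => rw [← Finset.univ_sum_single x]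
  rw [map_sum, dotR]
  refine Finset.sum_congr rfl fun i _ => ?_
  have : (Pi.single i (x i) : Fin n → ℝ) = x i • Pi.single i 1 := by
    rw [← Pi.single_smul]; simp
  rw [this, map_smul, smul_eq_mul, mul_comm]

theorem dotR_continuous {n : ℕ} (x : Fin n → ℝ) : Continuous (fun c : Fin n → ℝ => dotR c x) := by
  unfold dotR; fun_prop

theorem dotR_hyperplane_null {n : ℕ} {c : Fin n → ℝ} (hc : c ≠ 0) (m : ℝ) :
    volume {x : Fin n → ℝ | dotR c x = m} = 0 := by
  by_cases h : ∃ x0, dotR c x0 = m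
  · obtain ⟨x0, h0⟩ := h
    have : {x : Fin n → ℝ | dotR c x = m} = (AffineSubspace.mk' x0 (LinearMap.ker (dotL c)) : Set _) := by
      ext x
      simp [AffineSubspace.mem_mk', dotR_sub_right, h0, sub_eq_zero]
    rw [this]
    apply Measure.addHaar_affineSubspace
    intro htop
    have h1 : (c + x0) ∈ AffineSubspace.mk' x0 (LinearMap.ker (dotL c)) := by
      rw [htop]; trivial
    simp [AffineSubspace.mem_mk'] at h1
    apply hc
    unfold dotR at h1
    rw [Finset.sum_eq_zero_iff_of_nonneg (fun i _ => mul_self_nonneg _)] at h1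
    ext i
    simpa using h1 i (Finset.mem_univ i)
  · push Not at h
    simp [h]

/-- index set of minimizers of the lifted functional -/
def IsLow {d : ℕ} {ι : Type*} (p : ι → Fin d → ℝ) (ω : ι → ℝ) (c : Fin d → ℝ) (I : Finset ι) : Prop :=
  ∀ i, i ∈ I ↔ ∀ j, dotR c (p i) + ω i ≤ dotR c (p j) + ω j


theorem low_lift {d : ℕ} {ι : Type*} {p : ι → Fin d → ℝ} {ω : ι → ℝ} {I : Set ι} {x : Fin d → ℝ}
    (hx : x ∈ convexHull ℝ (p '' I)) : ∃ s, (x, s) ∈ convexHull ℝ ((fun i => (p i, ω i)) '' I) := by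
  have : p '' I = (LinearMap.fst ℝ (Fin d → ℝ) ℝ) '' ((fun i => (p i, ω i)) '' I) := by
    rw [Set.image_image]; rfl
  rw [this, ← LinearMap.image_convexHull] at hx
  obtain ⟨⟨y, s⟩, hy, rfl⟩ := hx
  exact ⟨s, hy⟩

theorem low_le {d : ℕ} {ι : Type*} {p : ι → Fin d → ℝ} {ω : ι → ℝ} {c : Fin d → ℝ}
    {m : ℝ} {I : Set ι} (hm : ∀ j ∈ I, m ≤ dotR c (p j) + ω j) {x : Fin d → ℝ} {s : ℝ}
    (hx : (x, s) ∈ convexHull ℝ ((fun i => (p i, ω i)) '' I)) : m ≤ dotR c x + s := by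
  have hc : Convex ℝ {y : (Fin d → ℝ) × ℝ | m ≤ dotR c y.1 + y.2} := by
    apply convex_halfSpace_ge
    constructor
    · intro x y; simp [dotR_add_right]; ring
    · intro r x; simp [dotR_smul_right]; ring
  refine convexHull_min ?_ hc hx
  rintro _ ⟨j, hj, rfl⟩
  exact hm j hj

theorem low_ge {d : ℕ} {ι : Type*} {p : ι → Fin d → ℝ} {ω : ι → ℝ} {c : Fin d → ℝ}
    {m : ℝ} {I : Set ι} (hm : ∀ j ∈ I, dotR c (p j) + ω j ≤ m) {x : Fin d → ℝ} {s : ℝ}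
    (hx : (x, s) ∈ convexHull ℝ ((fun i => (p i, ω i)) '' I)) : dotR c x + s ≤ m := by
  have hc : Convex ℝ {y : (Fin d → ℝ) × ℝ | dotR c y.1 + y.2 ≤ m} := by
    apply convex_halfSpace_le
    constructor
    · intro x y; simp [dotR_add_right]; ring
    · intro r x; simp [dotR_smul_right]; ring
  refine convexHull_min ?_ hc hx
  rintro _ ⟨j, hj, rfl⟩
  exact hm j hj

theorem low_inter_null {d : ℕ} {ι : Type*} {p : ι → Fin d → ℝ} {ω : ι → ℝ}
    {c c' : Fin d → ℝ} {I J : Finset ι} (hI : IsLow p ω c I) (hJ : IsLow p ω c' J) (hIJ : I ≠ J) :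
    volume (convexHull ℝ (p '' I) ∩ convexHull ℝ (p '' J)) = 0 := by
  have hc : c - c' ≠ 0 := by
    intro h
    apply hIJ
    rw [sub_eq_zero] at h
    subst h
    ext i; rw [hI i, hJ i]
  rcases I.eq_empty_or_nonempty with rfl | ⟨i, hi⟩
  · simp
  rcases J.eq_empty_or_nonempty with rfl | ⟨j, hj⟩
  · simp
  refine measure_mono_null ?_ (dotR_hyperplane_null hc ((dotR c (p i) + ω i) - (dotR c' (p j) + ω j)))
  rintro x ⟨hx, hx'⟩
  obtain ⟨s, hs⟩ := low_lift (ω := ω) hx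
  obtain ⟨s', hs'⟩ := low_lift (ω := ω) hx'
  have h1 := low_le (fun k _ => (hI i).1 hi k) hs
  have h2 := low_ge (fun k hk => (hI k).1 hk i) hs
  have h3 := low_le (fun k _ => (hI i).1 hi k) hs'
  have h1' := low_le (fun k _ => (hJ j).1 hj k) hs
  have h2' := low_ge (fun k hk => (hJ k).1 hk j) hs'
  have h3' := low_le (fun k _ => (hJ j).1 hj k) hs'
  have h4 : dotR (c - c') x = dotR c x - dotR c' x := by
    rw [dotR_comm', dotR_sub_right, dotR_comm' x, dotR_comm' x]
  simp only [Set.mem_setOf_eq, h4]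
  linarith

theorem dotR_self_ge {d : ℕ} (c : Fin d → ℝ) : ‖c‖ * ‖c‖ ≤ dotR c c := by
  have h0 : 0 ≤ dotR c c := Finset.sum_nonneg fun i _ => mul_self_nonneg _
  have : ‖c‖ ≤ Real.sqrt (dotR c c) := by
    rw [pi_norm_le_iff_of_nonneg (Real.sqrt_nonneg _)]
    intro i
    apply Real.le_sqrt_of_sq_le
    rw [Real.norm_eq_abs, sq_abs, sq]
    exact Finset.single_le_sum (f := fun i => c i * c i) (fun i _ => mul_self_nonneg _) (Finset.mem_univ i)
  nlinarith [Real.mul_self_sqrt h0, norm_nonneg c, Real.sqrt_nonneg (dotR c c)]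

theorem low_cover {d : ℕ} {ι : Type*} [Fintype ι] [Nonempty ι] (p : ι → Fin d → ℝ) (ω : ι → ℝ)
    {x : Fin d → ℝ} (hx : x ∈ interior (convexHull ℝ (Set.range p))) :
    ∃ c I, IsLow p ω c I ∧ x ∈ convexHull ℝ (p '' (I : Set ι)) := by
  classical
  let v : ι → (Fin d → ℝ) → ℝ := fun i c => dotR c (p i - x) + ω i
  have hvc : ∀ i, Continuous (v i) := fun i => (dotR_continuous _).add continuous_const
  let f : (Fin d → ℝ) → ℝ := fun c => Finset.univ.inf' Finset.univ_nonempty (fun i => v i c)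
  have hfc : Continuous f := Continuous.finset_inf'_apply _ fun i _ => hvc i
  -- coercivity
  obtain ⟨ε, hε, hball⟩ := Metric.isOpen_iff.1 isOpen_interior x hx
  obtain ⟨M, hM⟩ : ∃ M, ∀ i, ω i ≤ M := (Set.finite_range ω).bddAbove.imp fun M h i => h ⟨i, rfl⟩
  have hcoer : ∀ c, f c ≤ -(ε / 2) * ‖c‖ + M := by
    intro c
    by_cases hc : c = 0
    · subst hc
      have i := Classical.arbitrary ι
      refine (Finset.inf'_le _ (Finset.mem_univ i)).trans ?_
      simpa [v, dotR] using hM i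
    have hc' : 0 < ‖c‖ := norm_pos_iff.2 hc
    let y := x - (ε / 2 / ‖c‖) • c
    have hy : y ∈ convexHull ℝ (Set.range p) := by
      apply interior_subset
      apply hball
      rw [Metric.mem_ball, dist_eq_norm]
      simp only [y, sub_sub_cancel_left, norm_neg, norm_smul, Real.norm_eq_abs]
      rw [abs_of_pos (by positivity), div_mul_cancel₀ _ hc'.ne']
      linarith
    have hy2 : dotR c (y - x) ≤ -(ε / 2) * ‖c‖ := by
      simp only [y, sub_sub_cancel_left]
      rw [← neg_smul, dotR_smul_right]
      have := dotR_self_ge c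
      have h3 : ε / 2 / ‖c‖ * (‖c‖ * ‖c‖) = ε / 2 * ‖c‖ := by field_simp
      have h4 := mul_le_mul_of_nonneg_left this (show 0 ≤ ε / 2 / ‖c‖ by positivity)
      linarith
    by_contra hcon
    push Not at hcon
    have hcv : Convex ℝ {z | -(ε / 2) * ‖c‖ + dotR c x < dotR c z} := by
      apply convex_halfSpace_gt
      exact (dotL c).isLinear
    have : y ∈ {z | -(ε / 2) * ‖c‖ + dotR c x < dotR c z} := by
      refine convexHull_min ?_ hcv hy
      rintro _ ⟨i, rfl⟩
      have h1 : f c ≤ v i c := Finset.inf'_le _ (Finset.mem_univ i)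
      simp only [v, dotR_sub_right] at h1
      have := hM i
      simp only [Set.mem_setOf_eq]
      linarith
    simp only [Set.mem_setOf_eq] at this
    rw [dotR_sub_right] at hy2
    linarith
  -- maximum
  obtain ⟨c, hc⟩ : ∃ c, ∀ e, f e ≤ f c := by
    apply hfc.exists_forall_ge
    have h1 : Filter.Tendsto (fun c : Fin d → ℝ => -(ε / 2) * ‖c‖ + M) (Filter.cocompact _) Filter.atBot := by
      apply Filter.tendsto_atBot_add_const_right
      apply (tendsto_norm_cocompact_atTop).const_mul_atTop_of_neg
      linarith
    exact Filter.tendsto_atBot_mono hcoer h1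
  let I : Finset ι := Finset.univ.filter fun i => v i c = f c
  have hfv : ∀ i, f c ≤ v i c := fun i => Finset.inf'_le _ (Finset.mem_univ i)
  obtain ⟨i0, -, hi0⟩ := Finset.exists_mem_eq_inf' (Finset.univ_nonempty (α := ι)) (fun i => v i c)
  have hi0 : f c = v i0 c := hi0
  refine ⟨c, I, ?_, ?_⟩
  · intro i
    have key : ∀ i j, (dotR c (p i) + ω i ≤ dotR c (p j) + ω j) ↔ v i c ≤ v j c := by
      intro i j; simp only [v, dotR_sub_right]; constructor <;> intro h <;> linarith
    simp only [key, I, Finset.mem_filter, Finset.mem_univ, true_and]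
    constructor
    · intro h j; rw [h]; exact hfv j
    · intro h; exact le_antisymm (by rw [hi0]; exact h i0) (hfv i)
  · by_contra hnot
    have hcomp : IsCompact (convexHull ℝ (p '' (I : Set ι))) :=
      ((I.finite_toSet.image p)).isCompact_convexHull ℝ
    obtain ⟨e', u, hu1, hu2⟩ := geometric_hahn_banach_point_closed (convex_convexHull ℝ _) hcomp.isClosed hnot
    obtain ⟨e, he⟩ := exists_dotR (e' : (Fin d → ℝ) →ₗ[ℝ] ℝ)
    have hpos : ∀ i ∈ I, 0 < dotR e (p i - x) := by
      intro i hi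
      have h1 := hu2 (p i) (subset_convexHull ℝ _ ⟨i, hi, rfl⟩)
      have h2 := he (p i)
      have h3 := he x
      simp only [ContinuousLinearMap.coe_coe] at h2 h3
      rw [dotR_sub_right]; linarith
    have hev : ∀ i, ∀ᶠ δ : ℝ in nhdsWithin 0 (Set.Ioi 0), f c < v i (c + δ • e) := by
      intro i
      by_cases hi : i ∈ I
      · filter_upwards [self_mem_nhdsWithin] with δ hδ
        have h1 : v i c = f c := by simpa [I] using hi
        have h2 := mul_pos hδ (hpos i hi)
        simp only [v, dotR_add_left, dotR_smul_left] at h1 ⊢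
        linarith
      · have h1 : f c < v i c := lt_of_le_of_ne (hfv i) (fun h => hi (by simp [I, h]))
        have h2 : Continuous fun δ : ℝ => v i (c + δ • e) := (hvc i).comp (by fun_prop)
        have h3 : ∀ᶠ δ in nhds (0:ℝ), f c < v i (c + δ • e) := by
          apply h2.continuousAt.eventually (p := fun t => f c < t)
          simp only [zero_smul, add_zero]
          exact lt_mem_nhds h1
        exact h3.filter_mono nhdsWithin_le_nhds
    obtain ⟨δ, hδ⟩ := (Filter.eventually_all.2 hev).exists
    have : f c < f (c + δ • e) := by
      rw [Finset.lt_inf'_iff]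
      exact fun i _ => hδ i
    exact absurd (hc _) (not_le.2 this)

open Classical in
theorem volume_subdivision {d : ℕ} {ι : Type*} [Fintype ι] [Nonempty ι] (p : ι → Fin d → ℝ) (ω : ι → ℝ) :
    volume (convexHull ℝ (Set.range p)) =
      ∑ I ∈ Finset.univ.filter (fun I : Finset ι => ∃ c, IsLow p ω c I),
        volume (convexHull ℝ (p '' (I : Set ι))) := by
  have hcl : ∀ I : Finset ι, IsClosed (convexHull ℝ (p '' (I : Set ι))) := fun I =>
    (((I.finite_toSet.image p)).isCompact_convexHull ℝ).isClosed
  rw [← measure_biUnion_finset₀]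
  · apply le_antisymm
    · rw [← measure_congr (show interior (convexHull ℝ (Set.range p)) =ᵐ[volume] convexHull ℝ (Set.range p) from ?_)]
      · apply measure_mono
        intro x hx
        obtain ⟨c, I, h1, h2⟩ := low_cover p ω hx
        simp only [Set.mem_iUnion]
        exact ⟨I, by simp; exact ⟨c, h1⟩, h2⟩
      · exact interior_ae_eq_of_null_frontier ((convex_convexHull ℝ _).addHaar_frontier volume)
    · apply measure_mono
      simp only [Set.iUnion_subset_iff]
      intro I _
      exact convexHull_mono (Set.image_subset_range _ _)
  · intro I hI J hJ hIJ
    simp only [Finset.coe_filter, Finset.mem_univ, true_and, Set.mem_setOf_eq] at hI hJ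
    obtain ⟨c, hc⟩ := hI
    obtain ⟨c', hc'⟩ := hJ
    exact low_inter_null hc hc' hIJ
  · intro I _
    exact (hcl I).measurableSet.nullMeasurableSet


/-- cast of integer vectors -/
def icast {n : ℕ} (v : Fin n → ℤ) : Fin n → ℝ := fun i => ((v i : ℤ) : ℝ)

theorem icast_int {n : ℕ} (v : Fin n → ℤ) : IsIntPt (icast v) := fun i => ⟨v i, rfl⟩

theorem IsIntPt.add {n : ℕ} {x y : Fin n → ℝ} (hx : IsIntPt x) (hy : IsIntPt y) : IsIntPt (x + y) := by
  intro i
  obtain ⟨a, ha⟩ := hx i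
  obtain ⟨b, hb⟩ := hy i
  exact ⟨a + b, by simp [ha, hb]⟩

theorem IsIntPt.sub {n : ℕ} {x y : Fin n → ℝ} (hx : IsIntPt x) (hy : IsIntPt y) : IsIntPt (x - y) := by
  intro i
  obtain ⟨a, ha⟩ := hx i
  obtain ⟨b, hb⟩ := hy i
  exact ⟨a - b, by simp [ha, hb]⟩

/-- The lattice of integer points of a subspace. -/
def intLat {n : ℕ} (D : Submodule ℝ (Fin n → ℝ)) : Submodule ℤ D where
  carrier := {x | IsIntPt (x : Fin n → ℝ)}
  add_mem' hx hy := IsIntPt.add hx hy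
  zero_mem' := fun i => ⟨0, by simp⟩
  smul_mem' z x hx := by
    intro i
    obtain ⟨a, ha⟩ := hx i
    exact ⟨z * a, by simp [ha]⟩

theorem mem_intLat {n : ℕ} (D : Submodule ℝ (Fin n → ℝ)) (x : D) : x ∈ intLat D ↔ IsIntPt (x : Fin n → ℝ) := Iff.rfl

instance intLat_discrete {n : ℕ} (D : Submodule ℝ (Fin n → ℝ)) : DiscreteTopology (intLat D) := by
  rw [discreteTopology_iff_isOpen_singleton_zero]
  rw [Metric.isOpen_singleton_iff]
  refine ⟨1, one_pos, ?_⟩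
  intro y hy
  ext i
  have h1 : dist (((y : D) : Fin n → ℝ) i) 0 < 1 :=
    lt_of_le_of_lt (dist_le_pi_dist ((y : D) : Fin n → ℝ) 0 i) hy
  obtain ⟨a, ha⟩ := y.2 i
  rw [Real.dist_eq, sub_zero] at h1
  change ((y : D) : Fin n → ℝ) i = 0
  rw [ha] at h1 ⊢
  have h2 : |a| < 1 := by exact_mod_cast h1
  rw [Int.abs_lt_one_iff] at h2
  simp [h2]

theorem exists_chart {n : ℕ} {P : Set (Fin n → ℝ)} (hP : IsLatticePolytope P) :
    ∃ φ : (Fin n → ℝ) →ᵃ[ℝ] (Fin (polyDim P) → ℝ), IsLatticeChart P φ := by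
  obtain ⟨V, ⟨v0, hv0⟩, rfl⟩ := hP
  set P := convexHull ℝ ((fun v (i : Fin n) => ((v i : ℤ) : ℝ)) '' (V : Set (Fin n → ℤ))) with hPdef
  set D := (affineSpan ℝ P).direction with hD
  have hx0 : icast v0 ∈ affineSpan ℝ P :=
    subset_affineSpan _ _ (subset_convexHull _ _ ⟨v0, hv0, rfl⟩)
  have hspan : Submodule.span ℝ (intLat D : Set D) = ⊤ := by
    rw [eq_top_iff]
    intro x _
    have hDs : D = Submodule.span ℝ ((fun x => x -ᵥ icast v0) ''
        ((fun v (i : Fin n) => ((v i : ℤ) : ℝ)) '' (V : Set (Fin n → ℤ)))) := by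
      rw [hD, hPdef, affineSpan_convexHull, direction_affineSpan]
      exact vectorSpan_eq_span_vsub_set_right ℝ (p := icast v0) ⟨v0, hv0, rfl⟩
    have hle : D ≤ (Submodule.span ℝ (intLat D : Set D)).map D.subtype := by
      refine hDs.le.trans (Submodule.span_le.2 ?_)
      rintro _ ⟨_, ⟨v, hv, rfl⟩, rfl⟩
      have hmem : icast v - icast v0 ∈ D := by
        rw [hD]
        exact AffineSubspace.vsub_mem_direction
          (subset_affineSpan _ _ (subset_convexHull _ _ ⟨v, hv, rfl⟩)) hx0
      refine ⟨⟨_, hmem⟩, Submodule.subset_span ?_, rfl⟩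
      exact (icast_int v).sub (icast_int v0)
    obtain ⟨y, hy, hyx⟩ := hle x.2
    have : y = x := Subtype.ext hyx
    rwa [← this]
  have : IsZLattice ℝ (intLat D) := ⟨hspan⟩
  have : Module.Finite ℤ (intLat D) := ZLattice.module_finite ℝ _
  have : Module.Free ℤ (intLat D) := ZLattice.module_free ℝ _
  have hrank : Module.finrank ℤ (intLat D) = polyDim P := by
    rw [ZLattice.rank ℝ]; rfl
  let b0 := Module.finBasisOfFinrankEq ℤ (intLat D) hrank
  let b := b0.ofZLatticeBasis ℝ (intLat D)
  have hb : ∀ x : D, IsIntPt (x : Fin n → ℝ) ↔ IsIntPt (b.equivFun x) := by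
    intro x
    rw [← mem_intLat, ← b0.ofZLatticeBasis_span ℝ (intLat D), Module.Basis.mem_span_iff_repr_mem]
    constructor
    · intro h i
      obtain ⟨z, hz⟩ := h i
      exact ⟨z, by rw [Module.Basis.equivFun_apply]; exact hz.symm⟩
    · intro h i
      obtain ⟨z, hz⟩ := h i
      exact ⟨z, by rw [Module.Basis.equivFun_apply] at hz; exact hz.symm⟩
  obtain ⟨π, hπ⟩ := D.subtype.exists_leftInverse_of_injective (by simp)
  have hπ' : ∀ x : D, π x = x := fun x => LinearMap.congr_fun hπ x
  let φ : (Fin n → ℝ) →ᵃ[ℝ] (Fin (polyDim P) → ℝ) :=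
    (b.equivFun.toLinearMap ∘ₗ π).toAffineMap.comp
      ((AffineMap.id ℝ (Fin n → ℝ)) - AffineMap.const ℝ _ (icast v0))
  have hφ : ∀ x : D, φ (x + icast v0) = b.equivFun x := by
    intro x
    simp [φ, hπ']
  have hrep : ∀ x ∈ affineSpan ℝ P, ∃ y : D, x = y + icast v0 := by
    intro x hx
    exact ⟨⟨x - icast v0, AffineSubspace.vsub_mem_direction hx hx0⟩, by simp⟩
  refine ⟨φ, ⟨fun _ _ => Set.mem_univ _, ?_, ?_⟩, ?_⟩
  · intro x hx y hy hxy
    obtain ⟨x, rfl⟩ := hrep x hx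
    obtain ⟨y, rfl⟩ := hrep y hy
    simp only [hφ] at hxy
    rw [b.equivFun.injective hxy]
  · intro y _
    refine ⟨(b.equivFun.symm y : D) + icast v0, ?_, ?_⟩
    · exact AffineSubspace.vadd_mem_of_mem_direction (b.equivFun.symm y).2 hx0
    · simp only [hφ]; exact b.equivFun.apply_symm_apply y
  · intro x hx
    obtain ⟨x, rfl⟩ := hrep x hx
    rw [hφ, ← hb]
    constructor
    · intro h; simpa using h.sub (icast_int v0)
    · intro h; exact h.add (icast_int v0)

theorem normVol_spec {n : ℕ} {P : Set (Fin n → ℝ)} (hP : IsLatticePolytope P) :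
    ∃ φ : (Fin n → ℝ) →ᵃ[ℝ] (Fin (polyDim P) → ℝ), IsLatticeChart P φ ∧
      normVol P = (Nat.factorial (polyDim P)) * (volume ((fun x => φ x) '' P)).toReal := by
  have h := exists_chart hP
  refine ⟨h.choose, h.choose_spec, ?_⟩
  rw [normVol, dif_pos h]

theorem chart_inverse {n r : ℕ} {P : Set (Fin n → ℝ)} (hne : P.Nonempty)
    {φ : (Fin n → ℝ) →ᵃ[ℝ] (Fin r → ℝ)} (hφ : IsLatticeChart P φ) :
    ∃ ψ : (Fin r → ℝ) →ᵃ[ℝ] (Fin n → ℝ), (∀ y, ψ y ∈ affineSpan ℝ P) ∧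
      (∀ x ∈ affineSpan ℝ P, ψ (φ x) = x) ∧ ∀ y, IsIntPt y → IsIntPt (ψ y) := by
  obtain ⟨⟨-, hinj, hsurj⟩, hint⟩ := hφ
  obtain ⟨x0, hx0⟩ := hne
  have hx0 : x0 ∈ affineSpan ℝ P := subset_affineSpan _ _ hx0
  set D := (affineSpan ℝ P).direction with hD
  let l : D →ₗ[ℝ] (Fin r → ℝ) := φ.linear ∘ₗ D.subtype
  have hl : ∀ x : D, φ (x + x0) = l x + φ x0 := fun x => by
    have := φ.map_vadd x0 x; simpa [l] using this
  have hmem : ∀ x : D, (x : Fin n → ℝ) + x0 ∈ affineSpan ℝ P := fun x =>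
    AffineSubspace.vadd_mem_of_mem_direction x.2 hx0
  have hbij : Function.Bijective l := by
    constructor
    · intro x y hxy
      have := hinj (hmem x) (hmem y) (by simp only [hl, hxy])
      exact Subtype.ext (by simpa using this)
    · intro y
      obtain ⟨x, hx, hxy⟩ := hsurj (Set.mem_univ (y + φ x0))
      refine ⟨⟨x - x0, AffineSubspace.vsub_mem_direction hx hx0⟩, ?_⟩
      have := hl ⟨x - x0, AffineSubspace.vsub_mem_direction hx hx0⟩
      simp only [sub_add_cancel] at this hxy
      rw [this] at hxy
      exact add_right_cancel hxy
  let e := LinearEquiv.ofBijective l hbij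
  let ψ : (Fin r → ℝ) →ᵃ[ℝ] (Fin n → ℝ) :=
    (D.subtype ∘ₗ e.symm.toLinearMap).toAffineMap.comp
      ((AffineMap.id ℝ (Fin r → ℝ)) - AffineMap.const ℝ _ (φ x0)) + AffineMap.const ℝ _ x0
  have hψ : ∀ y, ψ y = (e.symm (y - φ x0) : D) + x0 := fun y => by simp [ψ]
  have hφψ : ∀ y, φ (ψ y) = y := by
    intro y
    rw [hψ, hl]
    have : l (e.symm (y - φ x0)) = y - φ x0 := e.apply_symm_apply _
    rw [this]; simp
  have hm : ∀ y, ψ y ∈ affineSpan ℝ P := fun y => by rw [hψ]; exact hmem _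
  refine ⟨ψ, hm, ?_, ?_⟩
  · intro x hx
    exact hinj (hm _) hx (hφψ _)
  · intro y hy
    rw [hint _ (hm y), hφψ]; exact hy


theorem beta_nat (f g : ℕ) : ∫ x in (0:ℝ)..1, (1 - x) ^ f * x ^ g =
    (f.factorial * g.factorial : ℝ) / (f + g + 1).factorial := by
  induction f generalizing g with
  | zero =>
    simp [Nat.factorial_succ]
    field_simp
  | succ f ih =>
    have h1 : ∫ x in (0:ℝ)..1, ((g + 1 : ℝ) * ((1 - x) ^ (f + 1) * x ^ g) - (f + 1 : ℝ) * ((1 - x) ^ f * x ^ (g + 1))) = 0 := by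
      rw [intervalIntegral.integral_eq_sub_of_hasDerivAt (f := fun x : ℝ => (1 - x) ^ (f + 1) * x ^ (g + 1))]
      · simp
      · intro x _
        have h2 : HasDerivAt (fun x : ℝ => 1 - x) (-1) x := by
          simpa using (hasDerivAt_id x).const_sub 1
        have := (h2.pow (f + 1)).mul (hasDerivAt_pow (g + 1) x)
        convert! this using 1
        simp
        ring
      · apply Continuous.intervalIntegrable; fun_prop
    rw [intervalIntegral.integral_sub (by apply Continuous.intervalIntegrable; fun_prop)
      (by apply Continuous.intervalIntegrable; fun_prop), intervalIntegral.integral_const_mul,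
      intervalIntegral.integral_const_mul, ih (g + 1)] at h1
    have h3 : f + (g + 1) + 1 = f + 1 + g + 1 := by ring
    rw [h3] at h1
    have hg : (g + 1 : ℝ) ≠ 0 := by positivity
    rw [eq_div_iff (by positivity)]
    have h4 : ((f + 1 + g + 1).factorial : ℝ) ≠ 0 := by positivity
    rw [Nat.factorial_succ f, Nat.factorial_succ g] at *
    field_simp at h1
    push_cast at *
    apply mul_left_cancel₀ hg
    linear_combination h1

/-- standard join -/
def stdJoin {f g : ℕ} (A : Set (Fin f → ℝ)) (B : Set (Fin g → ℝ)) :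
    Set (((Fin f → ℝ) × (Fin g → ℝ)) × ℝ) :=
  (fun q : ((Fin f → ℝ) × (Fin g → ℝ)) × ℝ => (((1 - q.2) • q.1.1, q.2 • q.1.2), q.2)) ''
    ((A ×ˢ B) ×ˢ Set.Icc (0:ℝ) 1)

theorem stdJoin_compact {f g : ℕ} {A : Set (Fin f → ℝ)} {B : Set (Fin g → ℝ)}
    (hA : IsCompact A) (hB : IsCompact B) : IsCompact (stdJoin A B) :=
  ((hA.prod hB).prod isCompact_Icc).image (by fun_prop)

theorem volume_stdJoin {f g : ℕ} {A : Set (Fin f → ℝ)} {B : Set (Fin g → ℝ)}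
    (hA : IsCompact A) (hB : IsCompact B) : volume (stdJoin A B) =
      ENNReal.ofReal ((f.factorial * g.factorial : ℝ) / (f + g + 1).factorial) * (volume A * volume B) := by
  rw [Measure.volume_eq_prod, Measure.prod_apply_symm (stdJoin_compact hA hB).measurableSet]
  have h1 : ∀ t : ℝ, volume ((fun x => (x, t)) ⁻¹' stdJoin A B) =
      (Set.Icc (0:ℝ) 1).indicator (fun t => ENNReal.ofReal ((1 - t) ^ f * t ^ g) * (volume A * volume B)) t := by
    intro t
    by_cases ht : t ∈ Set.Icc (0:ℝ) 1
    · rw [Set.indicator_of_mem ht]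
      have : ((fun x => (x, t)) ⁻¹' stdJoin A B) = ((1 - t) • A) ×ˢ (t • B) := by
        ext ⟨u, w⟩
        simp only [stdJoin, Set.mem_preimage, Set.mem_image, Set.mem_prod, Prod.mk.injEq, Prod.exists,
          Set.mem_smul_set]
        constructor
        · rintro ⟨a, b, s, ⟨⟨ha, hb⟩, hs⟩, ⟨h1, h2⟩, rfl⟩
          exact ⟨⟨a, ha, h1⟩, ⟨b, hb, h2⟩⟩
        · rintro ⟨⟨a, ha, h1⟩, ⟨b, hb, h2⟩⟩
          exact ⟨a, b, t, ⟨⟨ha, hb⟩, ht⟩, ⟨h1, h2⟩, rfl⟩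
      rw [this, Measure.volume_eq_prod, Measure.prod_prod, Measure.addHaar_smul, Measure.addHaar_smul]
      have h0 : 0 ≤ 1 - t := by linarith [ht.2]
      have h0' : 0 ≤ t := ht.1
      simp only [Module.finrank_fin_fun]
      rw [abs_of_nonneg (by positivity), abs_of_nonneg (by positivity), ENNReal.ofReal_mul (by positivity)]
      ring
    · rw [Set.indicator_of_notMem ht]
      convert! measure_empty (μ := (volume : Measure ((Fin f → ℝ) × (Fin g → ℝ))))
      ext ⟨u, w⟩
      simp only [stdJoin, Set.mem_preimage, Set.mem_image, Set.mem_prod, Prod.mk.injEq, Prod.exists,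
          Set.mem_empty_iff_false, iff_false]
      rintro ⟨a, b, s, ⟨⟨ha, hb⟩, hs⟩, ⟨h1, h2⟩, rfl⟩
      exact ht hs
  simp_rw [h1]
  rw [lintegral_indicator measurableSet_Icc, lintegral_mul_const _ (by fun_prop)]
  congr 1
  rw [← beta_nat, intervalIntegral.integral_of_le zero_le_one, ← integral_Icc_eq_integral_Ioc,
    ofReal_integral_eq_lintegral_ofReal]
  · apply Continuous.integrableOn_Icc; fun_prop
  · filter_upwards [ae_restrict_mem measurableSet_Icc] with t ht
    have h0 : 0 ≤ 1 - t := by linarith [ht.2]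
    have h0' : 0 ≤ t := ht.1
    simp only [Pi.zero_apply]
    positivity

theorem det_int {d : ℕ} (L : (Fin d → ℝ) →ₗ[ℝ] (Fin d → ℝ)) (hL : ∀ x, IsIntPt x → IsIntPt (L x)) :
    ∃ z : ℤ, LinearMap.det L = z := by
  have h1 : ∀ j, IsIntPt (L (Pi.single j 1)) := by
    intro j
    apply hL
    intro i
    by_cases h : i = j
    · subst h; exact ⟨1, by simp⟩
    · exact ⟨0, by simp [h]⟩
  choose m hm using h1
  let M : Matrix (Fin d) (Fin d) ℤ := Matrix.of fun i j => m j i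
  refine ⟨M.det, ?_⟩
  rw [← LinearMap.det_toMatrix', ← eq_intCast (Int.castRingHom ℝ), RingHom.map_det]
  congr 1
  ext i j
  simp [LinearMap.toMatrix'_apply, M, ← hm]

theorem exists_repack {f g d : ℕ} (hd : f + g + 1 = d) :
    ∃ G : (Fin d → ℝ) →ₗ[ℝ] (((Fin f → ℝ) × (Fin g → ℝ)) × ℝ), Function.Surjective G ∧
      MeasurePreserving G ∧ ∀ x, IsIntPt x → IsIntPt (G x).1.1 ∧ IsIntPt (G x).1.2 ∧ ∃ z : ℤ, (G x).2 = z := by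
  subst hd
  let σ : (Fin f ⊕ Fin g) ⊕ Fin 1 ≃ Fin (f + g + 1) :=
    (Equiv.sumCongr finSumFinEquiv (Equiv.refl _)).trans finSumFinEquiv
  let G : (Fin (f + g + 1) → ℝ) →ₗ[ℝ] (((Fin f → ℝ) × (Fin g → ℝ)) × ℝ) :=
    { toFun := fun x => ((fun i => x (σ (Sum.inl (Sum.inl i))), fun i => x (σ (Sum.inl (Sum.inr i)))), x (σ (Sum.inr 0)))
      map_add' := fun x y => rfl
      map_smul' := fun r x => rfl }
  refine ⟨G, ?_, ?_, ?_⟩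
  · rintro ⟨⟨u, w⟩, t⟩
    refine ⟨fun k => Sum.elim (Sum.elim u w) (fun _ => t) (σ.symm k), ?_⟩
    simp [G]
  · have e1 := (volume_measurePreserving_piCongrLeft (fun _ : Fin (f + g + 1) => ℝ) σ).symm
    have e2 := volume_measurePreserving_sumPiEquivProdPi (fun _ : (Fin f ⊕ Fin g) ⊕ Fin 1 => ℝ)
    have e3 := volume_measurePreserving_sumPiEquivProdPi (fun _ : (Fin f ⊕ Fin g) => ℝ)
    have e4 := volume_preserving_funUnique (Fin 1) ℝ
    exact (e3.prod e4).comp (e2.comp e1)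
  · intro x hx
    exact ⟨fun i => hx _, fun i => hx _, hx _⟩

theorem volume_image_join {f g d : ℕ} (hd : f + g + 1 = d)
    (L : (((Fin f → ℝ) × (Fin g → ℝ)) × ℝ) →ₗ[ℝ] (Fin d → ℝ))
    (hL : ∀ x : ((Fin f → ℝ) × (Fin g → ℝ)) × ℝ, IsIntPt x.1.1 → IsIntPt x.1.2 → (∃ z : ℤ, x.2 = (z : ℝ)) → IsIntPt (L x)) :
    ∃ z : ℤ, ∀ S, MeasurableSet S → volume (L '' S) = ENNReal.ofReal |(z:ℝ)| * volume S := by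
  obtain ⟨G, hs, hG, hi⟩ := exists_repack (f := f) (g := g) hd
  obtain ⟨z, hz⟩ := det_int (L ∘ₗ G) (fun x hx => hL _ (hi x hx).1 (hi x hx).2.1 (hi x hx).2.2)
  refine ⟨z, fun S hS => ?_⟩
  rw [← hz, ← hG.measure_preimage hS.nullMeasurableSet, ← Measure.addHaar_image_linearMap,
    LinearMap.coe_comp, Set.image_comp, Set.image_preimage_eq _ hs]


theorem IsLatticePolytope.compact {n : ℕ} {P : Set (Fin n → ℝ)} (h : IsLatticePolytope P) : IsCompact P := by
  obtain ⟨V, -, rfl⟩ := h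
  exact (V.finite_toSet.image _).isCompact_convexHull ℝ

theorem IsLatticePolytope.nonempty {n : ℕ} {P : Set (Fin n → ℝ)} (h : IsLatticePolytope P) : P.Nonempty := by
  obtain ⟨V, ⟨v, hv⟩, rfl⟩ := h
  exact ⟨_, subset_convexHull _ _ ⟨v, hv, rfl⟩⟩

theorem IsLatticePolytope.convex {n : ℕ} {P : Set (Fin n → ℝ)} (h : IsLatticePolytope P) : Convex ℝ P := by
  obtain ⟨V, -, rfl⟩ := h
  exact convex_convexHull _ _

theorem affine_lin {a b : ℕ} (α : (Fin a → ℝ) →ᵃ[ℝ] (Fin b → ℝ)) (x) : α x = α.linear x + α 0 := by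
  have := α.map_vadd 0 x; simpa using this

theorem int_zero {n : ℕ} : IsIntPt (0 : Fin n → ℝ) := fun _ => ⟨0, by simp⟩

theorem IsIntPt.zsmul {n : ℕ} {x : Fin n → ℝ} (hx : IsIntPt x) (z : ℤ) : IsIntPt ((z : ℝ) • x) := by
  intro i
  obtain ⟨a, ha⟩ := hx i
  exact ⟨z * a, by simp [ha]⟩

theorem affine_cont {a b : ℕ} (α : (Fin a → ℝ) →ᵃ[ℝ] (Fin b → ℝ)) : Continuous α :=
  α.continuous_of_finiteDimensional

theorem cell_vol {n d : ℕ} {F G : Set (Fin n → ℝ)} (hF : IsLatticePolytope F) (hG : IsLatticePolytope G)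
    (φ : (Fin n → ℝ) →ᵃ[ℝ] (Fin d → ℝ)) (A : AffineSubspace ℝ (Fin n → ℝ))
    (hφ : ∀ x ∈ A, IsIntPt x → IsIntPt (φ x)) (hFA : F ⊆ A) (hGA : G ⊆ A)
    (hd : polyDim F + polyDim G + 1 = d) :
    ∃ z : ℤ, (d.factorial : ℝ) * (volume (φ '' convexHull ℝ (F ∪ G))).toReal = z * (normVol F * normVol G) := by
  obtain ⟨φF, hcF, hvF⟩ := normVol_spec hF
  obtain ⟨φG, hcG, hvG⟩ := normVol_spec hG
  obtain ⟨ψF, hF1, hF2, hF3⟩ := chart_inverse hF.nonempty hcF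
  obtain ⟨ψG, hG1, hG2, hG3⟩ := chart_inverse hG.nonempty hcG
  let α := φ.comp ψF
  let β := φ.comp ψG
  have hα : ∀ y, IsIntPt y → IsIntPt (α y) := fun y hy =>
    hφ _ (affineSpan_le.2 hFA (hF1 y)) (hF3 y hy)
  have hβ : ∀ y, IsIntPt y → IsIntPt (β y) := fun y hy =>
    hφ _ (affineSpan_le.2 hGA (hG1 y)) (hG3 y hy)
  have hαl : ∀ y, IsIntPt y → IsIntPt (α.linear y) := fun y hy => by
    have := (hα y hy).sub (hα 0 int_zero); rwa [affine_lin α y, add_sub_cancel_right] at this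
  have hβl : ∀ y, IsIntPt y → IsIntPt (β.linear y) := fun y hy => by
    have := (hβ y hy).sub (hβ 0 int_zero); rwa [affine_lin β y, add_sub_cancel_right] at this
  have hαF : ∀ x ∈ F, φ x = α.linear (φF x) + α 0 := fun x hx => by
    rw [← affine_lin]
    change _ = φ (ψF (φF x))
    rw [hF2 _ (subset_affineSpan _ _ hx)]
  have hβG : ∀ x ∈ G, φ x = β.linear (φG x) + β 0 := fun x hx => by
    rw [← affine_lin]
    change _ = φ (ψG (φG x))
    rw [hG2 _ (subset_affineSpan _ _ hx)]
  let L : (((Fin (polyDim F) → ℝ) × (Fin (polyDim G) → ℝ)) × ℝ) →ₗ[ℝ] (Fin d → ℝ) :=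
    α.linear ∘ₗ LinearMap.fst ℝ _ _ ∘ₗ LinearMap.fst ℝ _ _
    + β.linear ∘ₗ LinearMap.snd ℝ _ _ ∘ₗ LinearMap.fst ℝ _ _
    + (LinearMap.snd ℝ _ ℝ).smulRight (β 0 - α 0)
  have hLa : ∀ u w t, L ((u, w), t) = α.linear u + β.linear w + t • (β 0 - α 0) := fun u w t => rfl
  obtain ⟨z, hz⟩ := volume_image_join hd L (by
    rintro ⟨⟨u, w⟩, t⟩ hu hw ⟨m, hm⟩
    simp only at hm hu hw
    rw [hLa, hm]
    exact ((hαl _ hu).add (hβl _ hw)).add (((hβ _ int_zero).sub (hα _ int_zero)).zsmul m))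
  have himg : φ '' convexHull ℝ (F ∪ G) =
      (fun x => x + α 0) '' (L '' stdJoin ((fun x => φF x) '' F) ((fun x => φG x) '' G)) := by
    have key : ∀ x ∈ F, ∀ y ∈ G, ∀ s t : ℝ, s + t = 1 → φ (s • x + t • y) = L (((1 - t) • φF x, t • φG y), t) + α 0 := by
      intro x hx y hy s t hst
      have hs : s = 1 - t := by linarith
      rw [Convex.combo_affine_apply hst, hαF x hx, hβG y hy, hLa, hs, map_smul, map_smul]
      module
    rw [hF.convex.convexHull_union hG.convex hF.nonempty hG.nonempty]
    ext w
    simp only [Set.mem_image, mem_convexJoin, stdJoin]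
    constructor
    · rintro ⟨_, ⟨x, hx, y, hy, ⟨s, t, hs, ht, hst, rfl⟩⟩, rfl⟩
      exact ⟨_, ⟨_, ⟨((φF x, φG y), t), ⟨⟨⟨x, hx, rfl⟩, ⟨y, hy, rfl⟩⟩, ht, by linarith⟩, rfl⟩, rfl⟩,
        (key x hx y hy s t hst).symm⟩
    · rintro ⟨_, ⟨_, ⟨⟨⟨_, _⟩, t⟩, ⟨⟨⟨x, hx, rfl⟩, ⟨y, hy, rfl⟩⟩, ht⟩, rfl⟩, rfl⟩, rfl⟩
      exact ⟨_, ⟨x, hx, y, hy, ⟨1 - t, t, by linarith [ht.2], ht.1, by ring, rfl⟩⟩,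
        key x hx y hy (1 - t) t (by ring)⟩
  have hcA := hF.compact.image (affine_cont φF)
  have hcB := hG.compact.image (affine_cont φG)
  refine ⟨|z|, ?_⟩
  rw [himg, Set.image_add_right, measure_preimage_add_right, hz _ (stdJoin_compact hcA hcB).measurableSet, volume_stdJoin hcA hcB,
    hvF, hvG, ENNReal.toReal_mul, ENNReal.toReal_mul, ENNReal.toReal_mul, ENNReal.toReal_ofReal (abs_nonneg _),
    ENNReal.toReal_ofReal (by positivity), hd]
  have : (d.factorial : ℝ) ≠ 0 := by positivity
  push_cast
  field_simp

theorem cell_vol1 {n d : ℕ} {F : Set (Fin n → ℝ)} (hF : IsLatticePolytope F)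
    (φ : (Fin n → ℝ) →ᵃ[ℝ] (Fin d → ℝ)) (A : AffineSubspace ℝ (Fin n → ℝ))
    (hφ : ∀ x ∈ A, IsIntPt x → IsIntPt (φ x)) (hFA : F ⊆ A)
    (hd : polyDim F = d) :
    ∃ z : ℤ, (d.factorial : ℝ) * (volume (φ '' F)).toReal = z * normVol F := by
  subst hd
  obtain ⟨φF, hcF, hvF⟩ := normVol_spec hF
  obtain ⟨ψF, hF1, hF2, hF3⟩ := chart_inverse hF.nonempty hcF
  let α := φ.comp ψF
  have hα : ∀ y, IsIntPt y → IsIntPt (α y) := fun y hy =>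
    hφ _ (affineSpan_le.2 hFA (hF1 y)) (hF3 y hy)
  have hαl : ∀ y, IsIntPt y → IsIntPt (α.linear y) := fun y hy => by
    have := (hα y hy).sub (hα 0 int_zero); rwa [affine_lin α y, add_sub_cancel_right] at this
  have hαF : ∀ x ∈ F, φ x = α.linear (φF x) + α 0 := fun x hx => by
    rw [← affine_lin]
    change _ = φ (ψF (φF x))
    rw [hF2 _ (subset_affineSpan _ _ hx)]
  obtain ⟨z, hz⟩ := det_int α.linear hαl
  refine ⟨|z|, ?_⟩
  have himg : φ '' F = (fun x => x + α 0) '' (α.linear '' ((fun x => φF x) '' F)) := by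
    rw [Set.image_image, Set.image_image]
    exact Set.image_congr hαF
  rw [himg, Set.image_add_right, measure_preimage_add_right, Measure.addHaar_image_linearMap, hz, hvF,
    ENNReal.toReal_mul, ENNReal.toReal_ofReal (abs_nonneg _)]
  push_cast
  ring

/-- low-dimensional sets have null image -/
theorem cell_null {n d : ℕ} {S : Set (Fin n → ℝ)} (φ : (Fin n → ℝ) →ᵃ[ℝ] (Fin d → ℝ))
    (h : polyDim S < d) : volume (φ '' S) = 0 := by
  refine measure_mono_null (show φ '' S ⊆ ((affineSpan ℝ S).map φ : Set _) from ?_) ?_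
  · exact Set.image_mono (subset_affineSpan ℝ S)
  · apply Measure.addHaar_affineSubspace
    intro htop
    have h1 := congrArg AffineSubspace.direction htop
    rw [AffineSubspace.map_direction, AffineSubspace.direction_top] at h1
    have h2 := Submodule.finrank_map_le φ.linear (affineSpan ℝ S).direction
    rw [h1, finrank_top, Module.finrank_fin_fun] at h2
    unfold polyDim at h
    omega


theorem argmin_hull {n : ℕ} (S : Set (Fin n → ℝ)) (c : Fin n → ℝ) (m : ℝ)
    (hm : ∀ s ∈ S, m ≤ dotR c s) (hex : ∃ s ∈ S, dotR c s = m) :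
    argminSet c (convexHull ℝ S) = convexHull ℝ {s ∈ S | dotR c s = m} := by
  classical
  have hge : ∀ y ∈ convexHull ℝ S, m ≤ dotR c y := by
    intro y hy
    exact convexHull_min (t := {y | m ≤ dotR c y}) hm (convex_halfSpace_ge (dotL c).isLinear m) hy
  obtain ⟨s0, hs0, hs0m⟩ := hex
  ext x
  constructor
  · rintro ⟨hx, hmin⟩
    have hxm : dotR c x = m := le_antisymm (hs0m ▸ hmin s0 (subset_convexHull _ _ hs0)) (hge x hx)
    rw [mem_convexHull_iff_exists_fintype] at hx
    obtain ⟨ι, _, w, z, hw0, hw1, hz, rfl⟩ := hx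
    have hzero : ∑ i, w i * (dotR c (z i) - m) = 0 := by
      rw [← dotL_apply, map_sum] at hxm
      simp only [mul_sub, Finset.sum_sub_distrib, ← Finset.sum_mul, hw1]
      simp only [map_smul, smul_eq_mul, dotL_apply] at hxm
      rw [hxm]; ring
    rw [Finset.sum_eq_zero_iff_of_nonneg
      (fun i _ => mul_nonneg (hw0 i) (sub_nonneg.2 (hm _ (hz i))))] at hzero
    have h1 : ∑ i, w i • z i = ∑ i ∈ Finset.univ.filter (fun i => w i ≠ 0), w i • z i := by
      rw [Finset.sum_filter_of_ne]
      intro i _ h h'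
      exact h (by simp [h'])
    rw [h1]
    apply (convex_convexHull ℝ _).sum_mem (fun i _ => hw0 i)
    · rw [Finset.sum_filter_ne_zero, hw1]
    · intro i hi
      apply subset_convexHull
      refine ⟨hz i, ?_⟩
      have := (mul_eq_zero.1 (hzero i (Finset.mem_univ i))).resolve_left (Finset.mem_filter.1 hi).2
      linarith
  · intro hx
    refine ⟨convexHull_mono (fun _ h => h.1) hx, fun y hy => ?_⟩
    have : dotR c x ≤ m :=
      convexHull_min (t := {y | dotR c y ≤ m}) (fun s hs => hs.2.le) (convex_halfSpace_le (dotL c).isLinear m) hx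
    exact this.trans (hge y hy)

/-- hull of integer points -/
def lhull {n : ℕ} (V : Finset (Fin n → ℤ)) : Set (Fin n → ℝ) := convexHull ℝ (icast '' (V : Set (Fin n → ℤ)))

theorem lhull_poly {n : ℕ} {V : Finset (Fin n → ℤ)} (hV : V.Nonempty) : IsLatticePolytope (lhull V) := ⟨V, hV, rfl⟩

theorem face_of_low {n : ℕ} (V T : Finset (Fin n → ℤ)) (hT : T.Nonempty) (hTV : T ⊆ V) (c : Fin n → ℝ)
    (h : ∀ v ∈ V, v ∈ T ↔ ∀ u ∈ V, dotR c (icast v) ≤ dotR c (icast u)) :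
    IsFace (lhull V) (lhull T) := by
  obtain ⟨v0, hv0⟩ := hT
  have h0 := (h v0 (hTV hv0)).1 hv0
  refine Or.inr ⟨c, ?_⟩
  rw [lhull, lhull, argmin_hull _ c (dotR c (icast v0))]
  · congr 1
    ext x
    constructor
    · rintro ⟨v, hv, rfl⟩
      exact ⟨⟨v, hTV hv, rfl⟩, le_antisymm ((h v (hTV hv)).1 hv _ (hTV hv0)) (h0 v (hTV hv))⟩
    · rintro ⟨⟨v, hv, rfl⟩, hx⟩
      exact ⟨v, (h v hv).2 fun u hu => by rw [hx]; exact h0 u hu, rfl⟩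
  · rintro _ ⟨v, hv, rfl⟩; exact h0 v hv
  · exact ⟨_, ⟨v0, hTV hv0, rfl⟩, rfl⟩

theorem face_is_lhull {n : ℕ} {V : Finset (Fin n → ℤ)} (hV : V.Nonempty) {F : Set (Fin n → ℝ)}
    (hF : IsFace (lhull V) F) (hne : F.Nonempty) : ∃ T, T.Nonempty ∧ T ⊆ V ∧ F = lhull T := by
  classical
  rcases hF with rfl | ⟨c, rfl⟩
  · exact absurd hne Set.not_nonempty_empty
  obtain ⟨v0, hv0, hmin⟩ := V.exists_min_image (fun v => dotR c (icast v)) hV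
  refine ⟨V.filter fun v => dotR c (icast v) = dotR c (icast v0), ⟨v0, by simp [hv0]⟩, Finset.filter_subset _ _, ?_⟩
  rw [lhull, lhull, argmin_hull _ c (dotR c (icast v0))]
  · congr 1
    ext x
    constructor
    · rintro ⟨⟨v, hv, rfl⟩, hx⟩
      exact ⟨v, by simpa using ⟨hv, hx⟩, rfl⟩
    · rintro ⟨v, hv, rfl⟩
      have hv : v ∈ V ∧ dotR c (icast v) = dotR c (icast v0) := by simpa using hv
      exact ⟨⟨v, hv.1, rfl⟩, hv.2⟩
  · rintro _ ⟨v, hv, rfl⟩; exact hmin v hv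
  · exact ⟨_, ⟨v0, hv0, rfl⟩, rfl⟩

theorem const_on_span {n : ℕ} {S : Set (Fin n → ℝ)} {c : Fin n → ℝ} {m : ℝ} (h : ∀ x ∈ S, dotR c x = m) :
    ∀ x ∈ affineSpan ℝ S, dotR c x = m := by
  intro x hx
  refine affineSpan_induction hx h ?_
  intro r u v w hu hv hw
  simp [dotR_add_right, dotR_smul_right, dotR_sub_right, hu, hv, hw]

theorem exists_generic {n : ℕ} {κ : Type*} [Finite κ] (A B : κ → AffineSubspace ℝ (Fin n → ℝ)) :
    ∃ (a : Fin n → ℝ) (t : ℝ), ∀ k (c : Fin n → ℝ) (m : ℝ), (∀ x ∈ A k, dotR c x = m) →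
      (∀ x ∈ B k, dotR c x + (dotR a x + t) = m) → (A k : Set (Fin n → ℝ)).Nonempty →
      (B k : Set (Fin n → ℝ)).Nonempty →
      (A k).direction ⊓ (B k).direction = ⊥ ∧ ∀ x ∈ A k, x ∉ B k := by
  classical
  let κ' := {k : κ // (A k).direction ⊓ (B k).direction ≠ ⊥}
  have hex : ∀ k : κ', ∃ v ∈ (A k).direction ⊓ (B k).direction, v ≠ 0 := fun k =>
    Submodule.exists_mem_ne_zero_of_ne_bot k.2
  choose v hv hv0 using hex
  obtain ⟨f, hf⟩ := Module.exists_dual_forall_apply_ne_zero (K := ℝ) v hv0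
  obtain ⟨a, ha⟩ := exists_dotR f
  let κ'' := {k : κ // ∃ x ∈ A k, x ∈ B k}
  have hex2 : ∀ k : κ'', ∃ x, x ∈ A k ∧ x ∈ B k := fun k => by
    obtain ⟨x, h1, h2⟩ := k.2; exact ⟨x, h1, h2⟩
  choose y hy1 hy2 using hex2
  obtain ⟨t, ht⟩ := (Set.finite_range (fun k : κ'' => - dotR a (y k))).exists_notMem
  refine ⟨a, t, fun k c m hA hB ⟨p, hp⟩ ⟨q, hq⟩ => ⟨?_, ?_⟩⟩
  · by_contra hne
    let k' : κ' := ⟨k, hne⟩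
    have h1 := hA _ (AffineSubspace.vadd_mem_of_mem_direction (hv k').1 hp)
    have h2 := hB _ (AffineSubspace.vadd_mem_of_mem_direction (hv k').2 hq)
    have h3 := hA p hp
    have h4 := hB q hq
    have h5 := hf k'
    rw [ha] at h5
    simp only [vadd_eq_add, dotR_add_right] at h1 h2
    apply h5
    linarith
  · intro x hx1 hx2
    let k' : κ'' := ⟨k, x, hx1, hx2⟩
    have h1 := hA _ (hy1 k')
    have h2 := hB _ (hy2 k')
    apply ht
    exact ⟨k', by simp only; linarith⟩

theorem dim_lower {n : ℕ} {A B C : AffineSubspace ℝ (Fin n → ℝ)} (hA : A ≤ C) (hB : B ≤ C)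
    (hAn : (A : Set (Fin n → ℝ)).Nonempty) (hBn : (B : Set (Fin n → ℝ)).Nonempty)
    (h1 : A.direction ⊓ B.direction = ⊥) (h2 : ∀ x ∈ A, x ∉ B) :
    Module.finrank ℝ A.direction + Module.finrank ℝ B.direction + 1 ≤ Module.finrank ℝ C.direction := by
  obtain ⟨x, hx⟩ := hAn
  obtain ⟨y, hy⟩ := hBn
  have h3 := Submodule.finrank_sup_add_finrank_inf_eq A.direction B.direction
  rw [h1, finrank_bot, add_zero] at h3
  rw [← h3]
  apply Submodule.finrank_lt_finrank_of_lt
  refine lt_of_le_of_ne (sup_le (AffineSubspace.direction_le hA) (AffineSubspace.direction_le hB)) ?_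
  intro heq
  have hmem : x -ᵥ y ∈ A.direction ⊔ B.direction := by
    rw [heq]; exact AffineSubspace.vsub_mem_direction (hA hx) (hB hy)
  obtain ⟨u, hu, w, hw, huw⟩ := Submodule.mem_sup.1 hmem
  have h4 : -u + x ∈ A := AffineSubspace.vadd_mem_of_mem_direction (A.direction.neg_mem hu) hx
  have h5 : w + y ∈ B := AffineSubspace.vadd_mem_of_mem_direction hw hy
  have h6 : -u + x = w + y := by
    rw [vsub_eq_sub] at huw
    have : x = u + w + y := by rw [huw]; abel
    rw [this]; abel
  rw [h6] at h4
  exact h2 _ h4 h5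

theorem dim_upper {n : ℕ} {F G : Set (Fin n → ℝ)} (hF : F.Nonempty) (hG : G.Nonempty) :
    polyDim (convexHull ℝ (F ∪ G)) ≤ polyDim F + polyDim G + 1 := by
  obtain ⟨x, hx⟩ := hF
  obtain ⟨y, hy⟩ := hG
  unfold polyDim
  rw [affineSpan_convexHull, AffineSubspace.span_union,
    AffineSubspace.direction_sup (subset_affineSpan ℝ _ hx) (subset_affineSpan ℝ _ hy)]
  refine (Submodule.finrank_add_le_finrank_add_finrank _ _).trans ?_
  refine add_le_add (Submodule.finrank_add_le_finrank_add_finrank _ _) ?_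
  refine (finrank_span_le_card _).trans ?_
  simp

theorem polyDim_mono {n : ℕ} {F G : Set (Fin n → ℝ)} (h : F ⊆ G) : polyDim F ≤ polyDim G :=
  Submodule.finrank_mono (AffineSubspace.direction_le (affineSpan_mono ℝ h))


theorem union_poly {n : ℕ} [DecidableEq (Fin n → ℤ)] (V W : Finset (Fin n → ℤ)) :
    convexHull ℝ (lhull V ∪ lhull W) = lhull (V ∪ W) := by
  rw [lhull, lhull, lhull, Finset.coe_union, Set.image_union]
  exact (convexHull ℝ).closure_sup_closure _ _

theorem main_mem {n : ℕ} (V W : Finset (Fin n → ℤ)) (hV : V.Nonempty) (hW : W.Nonempty) (J : AddSubgroup ℝ)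
    (h1 : ∀ F, IsFace (lhull V) F → F.Nonempty → polyDim F = polyDim (convexHull ℝ (lhull V ∪ lhull W)) → normVol F ∈ J)
    (h2 : ∀ G, IsFace (lhull W) G → G.Nonempty → polyDim G = polyDim (convexHull ℝ (lhull V ∪ lhull W)) → normVol G ∈ J)
    (h3 : ∀ F G, IsFace (lhull V) F → F.Nonempty → IsFace (lhull W) G → G.Nonempty →
      polyDim F + polyDim G + 1 = polyDim (convexHull ℝ (lhull V ∪ lhull W)) → normVol F * normVol G ∈ J) :
    normVol (convexHull ℝ (lhull V ∪ lhull W)) ∈ J := by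
  classical
  let ι := ↥V ⊕ ↥W
  have : Nonempty ι := ⟨Sum.inl ⟨_, hV.choose_spec⟩⟩
  let p : ι → Fin n → ℝ := Sum.elim (fun v => icast v.1) (fun w => icast w.1)
  have hRr : convexHull ℝ (lhull V ∪ lhull W) = convexHull ℝ (Set.range p) := by
    rw [union_poly, lhull]
    congr 1
    ext x
    rw [Finset.coe_union, Set.image_union]
    constructor
    · rintro (⟨v, hv, rfl⟩ | ⟨v, hv, rfl⟩)
      · exact ⟨Sum.inl ⟨v, hv⟩, rfl⟩
      · exact ⟨Sum.inr ⟨v, hv⟩, rfl⟩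
    · rintro ⟨i | i, rfl⟩
      · exact Or.inl ⟨i.1, i.2, rfl⟩
      · exact Or.inr ⟨i.1, i.2, rfl⟩
  have hRpoly : IsLatticePolytope (convexHull ℝ (lhull V ∪ lhull W)) := by
    rw [union_poly]; exact lhull_poly (hV.mono Finset.subset_union_left)
  set R := convexHull ℝ (lhull V ∪ lhull W) with hR
  obtain ⟨φ, hφ, hvol⟩ := normVol_spec hRpoly
  have hφint : ∀ x ∈ affineSpan ℝ R, IsIntPt x → IsIntPt (φ x) := fun x hx h => (hφ.2 x hx).1 h
  let TF : Finset ι → Finset (Fin n → ℤ) := fun I => (Finset.univ.filter fun v : ↥V => Sum.inl v ∈ I).image Subtype.val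
  let TG : Finset ι → Finset (Fin n → ℤ) := fun I => (Finset.univ.filter fun v : ↥W => Sum.inr v ∈ I).image Subtype.val
  have hTF : ∀ I v, v ∈ TF I ↔ ∃ h : v ∈ V, Sum.inl ⟨v, h⟩ ∈ I := by
    intro I v; simp [TF]
  have hTG : ∀ I v, v ∈ TG I ↔ ∃ h : v ∈ W, Sum.inr ⟨v, h⟩ ∈ I := by
    intro I v; simp [TG]
  have hTFV : ∀ I, TF I ⊆ V := fun I v hv => ((hTF I v).1 hv).1
  have hTGW : ∀ I, TG I ⊆ W := fun I v hv => ((hTG I v).1 hv).1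
  have hpI : ∀ I : Finset ι, convexHull ℝ (p '' (I : Set ι)) = lhull (TF I ∪ TG I) := by
    intro I
    rw [lhull]
    congr 1
    ext x
    constructor
    · rintro ⟨i | i, hi, rfl⟩
      · exact ⟨i.1, by simp only [Finset.coe_union, Set.mem_union]; exact Or.inl ((hTF I _).2 ⟨i.2, hi⟩), rfl⟩
      · exact ⟨i.1, by simp only [Finset.coe_union, Set.mem_union]; exact Or.inr ((hTG I _).2 ⟨i.2, hi⟩), rfl⟩
    · rintro ⟨v, hv, rfl⟩
      rcases Finset.mem_union.1 hv with hv | hv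
      · obtain ⟨h, hi⟩ := (hTF I v).1 hv
        exact ⟨_, hi, rfl⟩
      · obtain ⟨h, hi⟩ := (hTG I v).1 hv
        exact ⟨_, hi, rfl⟩
  have hFsub : ∀ I, lhull (TF I) ⊆ R := fun I => by
    rw [hR, union_poly]
    exact convexHull_mono (Set.image_mono (by exact_mod_cast (hTFV I).trans Finset.subset_union_left))
  have hGsub : ∀ I, lhull (TG I) ⊆ R := fun I => by
    rw [hR, union_poly]
    exact convexHull_mono (Set.image_mono (by exact_mod_cast (hTGW I).trans Finset.subset_union_right))
  obtain ⟨a, t, hgen⟩ := exists_generic (κ := Finset ι) (fun I => affineSpan ℝ (lhull (TF I)))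
    (fun I => affineSpan ℝ (lhull (TG I)))
  let ω : ι → ℝ := Sum.elim (fun _ => 0) (fun w => dotR a (icast w.1) + t)
  have himg : (fun x => φ x) '' R = convexHull ℝ (Set.range (fun i => φ (p i))) := by
    have h0 : (fun x => φ x) '' R = φ '' convexHull ℝ (Set.range p) :=
      congrArg (fun T => (fun x => φ x) '' T) hRr
    rw [h0, AffineMap.image_convexHull, ← Set.range_comp]
    rfl
  have hcell : ∀ I : Finset ι, convexHull ℝ ((fun i => φ (p i)) '' (I : Set ι)) = φ '' lhull (TF I ∪ TG I) := by
    intro I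
    rw [← hpI, AffineMap.image_convexHull, Set.image_image]
  rw [hvol, himg, volume_subdivision (fun i => φ (p i)) ω, ENNReal.toReal_sum, Finset.mul_sum]
  swap
  · intro I _
    exact (((I.finite_toSet.image _)).isCompact_convexHull ℝ).measure_lt_top.ne
  apply J.sum_mem
  intro I hI
  obtain ⟨c, hc⟩ := (Finset.mem_filter.1 hI).2
  rw [hcell]
  -- pull back the functional
  obtain ⟨c', hc'⟩ := exists_dotR (dotL c ∘ₗ φ.linear)
  have hcφ : ∀ x, dotR c (φ x) = dotR c' x + dotR c (φ 0) := by
    intro x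
    rw [affine_lin φ x, dotR_add_right, ← hc' x]; rfl
  set kk := dotR c (φ 0)
  have hlF : ∀ v (hv : v ∈ V), dotR c (φ (p (Sum.inl ⟨v, hv⟩))) + ω (Sum.inl ⟨v, hv⟩) = dotR c' (icast v) + kk := by
    intro v hv; simp [p, ω, hcφ]
  have hlG : ∀ v (hv : v ∈ W), dotR c (φ (p (Sum.inr ⟨v, hv⟩))) + ω (Sum.inr ⟨v, hv⟩) = dotR c' (icast v) + (dotR a (icast v) + t) + kk := by
    intro v hv; simp [p, ω, hcφ]; ring
  have hfaceF : (TF I).Nonempty → IsFace (lhull V) (lhull (TF I)) := by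
    rintro ⟨v0, hv0⟩
    refine face_of_low V (TF I) ⟨v0, hv0⟩ (hTFV I) c' ?_
    obtain ⟨hv0V, hv0I⟩ := (hTF I v0).1 hv0
    intro v hv
    rw [hTF]
    constructor
    · rintro ⟨_, hvI⟩ u hu
      have := (hc _).1 hvI (Sum.inl ⟨u, hu⟩)
      rw [hlF, hlF] at this
      linarith
    · intro h
      refine ⟨hv, (hc _).2 fun j => ?_⟩
      refine le_trans ?_ ((hc _).1 hv0I j)
      rw [hlF, hlF]
      linarith [h v0 hv0V]
  have hfaceG : (TG I).Nonempty → IsFace (lhull W) (lhull (TG I)) := by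
    rintro ⟨v0, hv0⟩
    refine face_of_low W (TG I) ⟨v0, hv0⟩ (hTGW I) (c' + a) ?_
    obtain ⟨hv0V, hv0I⟩ := (hTG I v0).1 hv0
    intro v hv
    rw [hTG]
    simp only [dotR_add_left]
    constructor
    · rintro ⟨_, hvI⟩ u hu
      have := (hc _).1 hvI (Sum.inr ⟨u, hu⟩)
      rw [hlG, hlG] at this
      linarith
    · intro h
      refine ⟨hv, (hc _).2 fun j => ?_⟩
      refine le_trans ?_ ((hc _).1 hv0I j)
      rw [hlG, hlG]
      linarith [h v0 hv0V]
  have single : ∀ F, IsLatticePolytope F → F ⊆ R → (polyDim F = polyDim R → normVol F ∈ J) →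
      ((polyDim R).factorial : ℝ) * (volume (φ '' F)).toReal ∈ J := by
    intro F hF hFR hJ
    rcases (polyDim_mono hFR).lt_or_eq with hlt | heq
    · rw [cell_null φ hlt]; simp
    · obtain ⟨z, hz⟩ := cell_vol1 hF φ (affineSpan ℝ R) hφint (hFR.trans (subset_affineSpan _ _)) heq
      rw [hz, ← zsmul_eq_mul]
      exact J.zsmul_mem (hJ heq) z
  rcases (TF I).eq_empty_or_nonempty with hF0 | hF0
  · rcases (TG I).eq_empty_or_nonempty with hG0 | hG0
    · rw [hF0, hG0]; simp [lhull]
    · rw [hF0, Finset.empty_union]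
      exact single _ (lhull_poly hG0) (hGsub I) (h2 _ (hfaceG hG0) (lhull_poly hG0).nonempty)
  · rcases (TG I).eq_empty_or_nonempty with hG0 | hG0
    · rw [hG0, Finset.union_empty]
      exact single _ (lhull_poly hF0) (hFsub I) (h1 _ (hfaceF hF0) (lhull_poly hF0).nonempty)
    · have pF := lhull_poly hF0
      have pG := lhull_poly hG0
      obtain ⟨v0, hv0⟩ := hF0
      obtain ⟨hv0V, hv0I⟩ := (hTF I v0).1 hv0
      have hg := hgen I c' (dotR c' (icast v0))
        (by
          rw [lhull, affineSpan_convexHull]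
          apply const_on_span
          rintro _ ⟨v, hv, rfl⟩
          obtain ⟨hvV, hvI⟩ := (hTF I v).1 hv
          have e1 := (hc _).1 hvI (Sum.inl ⟨v0, hv0V⟩)
          have e2 := (hc _).1 hv0I (Sum.inl ⟨v, hvV⟩)
          rw [hlF, hlF] at e1 e2
          linarith)
        (by
          intro x hx
          have : dotR (c' + a) x = dotR c' (icast v0) - t := by
            revert x
            rw [lhull, affineSpan_convexHull]
            apply const_on_span
            rintro _ ⟨v, hv, rfl⟩
            obtain ⟨hvV, hvI⟩ := (hTG I v).1 hv
            have e1 := (hc _).1 hvI (Sum.inl ⟨v0, hv0V⟩)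
            have e2 := (hc _).1 hv0I (Sum.inr ⟨v, hvV⟩)
            rw [hlF, hlG] at e1 e2
            rw [dotR_add_left]
            linarith
          rw [dotR_add_left] at this
          linarith)
        (pF.nonempty.mono (subset_affineSpan _ _)) (pG.nonempty.mono (subset_affineSpan _ _))
      have hle : polyDim (lhull (TF I)) + polyDim (lhull (TG I)) + 1 ≤ polyDim R :=
        dim_lower (affineSpan_mono ℝ (hFsub I)) (affineSpan_mono ℝ (hGsub I))
          (pF.nonempty.mono (subset_affineSpan _ _)) (pG.nonempty.mono (subset_affineSpan _ _)) hg.1 hg.2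
      rw [← union_poly]
      rcases hle.lt_or_eq with hlt | heq
      · rw [cell_null φ ((dim_upper pF.nonempty pG.nonempty).trans_lt hlt)]; simp
      · obtain ⟨z, hz⟩ := cell_vol pF pG φ (affineSpan ℝ R) hφint ((hFsub I).trans (subset_affineSpan _ _))
          ((hGsub I).trans (subset_affineSpan _ _)) heq
        rw [hz, ← zsmul_eq_mul]
        exact J.zsmul_mem (h3 _ _ (hfaceF ⟨v0, hv0⟩) pF.nonempty (hfaceG hG0) pG.nonempty heq) z

/-- integers as a subgroup of the reals -/
def ZR : AddSubgroup ℝ := (Int.castAddHom ℝ).range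

theorem mem_ZR {x : ℝ} : x ∈ ZR ↔ ∃ z : ℤ, (z : ℝ) = x := Iff.rfl

theorem ZR_mul {x y : ℝ} (hx : x ∈ ZR) (hy : y ∈ ZR) : x * y ∈ ZR := by
  obtain ⟨a, rfl⟩ := hx
  obtain ⟨b, rfl⟩ := hy
  exact ⟨a * b, by simp⟩

theorem normVol_pt {n : ℕ} (v : Fin n → ℤ) : normVol (lhull {v}) ∈ ZR := by
  obtain ⟨φ, -, h⟩ := normVol_spec (lhull_poly (Finset.singleton_nonempty v))
  have hd : polyDim (lhull {v}) = 0 := by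
    unfold polyDim lhull; simp
    rw [direction_affineSpan]; exact vectorSpan_singleton ℝ _
  rw [h]
  have hone : ∀ (m : ℕ) (S : Set (Fin m → ℝ)), m = 0 → S.Nonempty → volume S = 1 := by
    rintro m S rfl ⟨s, hs⟩
    have : S = Set.univ := by
      ext x; simp [Subsingleton.elim x s, hs]
    rw [this]
    simp [volume_pi]
  rw [hone _ _ hd ((lhull_poly (Finset.singleton_nonempty v)).nonempty.image _)]
  exact ⟨(polyDim (lhull {v})).factorial, by simp⟩

theorem normVol_int {n : ℕ} : ∀ (N : ℕ) (V : Finset (Fin n → ℤ)), V.card ≤ N → V.Nonempty → normVol (lhull V) ∈ ZR := by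
  classical
  intro N
  induction N with
  | zero =>
    intro V hV hne
    have := hne.card_pos
    omega
  | succ N ih =>
    intro V hV hne
    obtain ⟨v, hv⟩ := hne
    rcases (V.erase v).eq_empty_or_nonempty with h0 | h0
    · have : V = {v} := by
        rw [← Finset.insert_erase hv, h0]; rfl
      rw [this]; exact normVol_pt v
    · have hVe : V = V.erase v ∪ {v} := by
        rw [Finset.union_comm, ← Finset.insert_eq, Finset.insert_erase hv]
      have hcard : (V.erase v).card ≤ N := by
        rw [Finset.card_erase_of_mem hv]; omega
      have hA : ∀ F, IsFace (lhull (V.erase v)) F → F.Nonempty → normVol F ∈ ZR := by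
        intro F hF hFn
        obtain ⟨T, hT, hTV, rfl⟩ := face_is_lhull h0 hF hFn
        exact ih T ((Finset.card_le_card hTV).trans hcard) hT
      have hB : ∀ F, IsFace (lhull {v}) F → F.Nonempty → normVol F ∈ ZR := by
        intro F hF hFn
        obtain ⟨T, hT, hTV, rfl⟩ := face_is_lhull (Finset.singleton_nonempty v) hF hFn
        rw [(Finset.subset_singleton_iff.1 hTV).resolve_left hT.ne_empty]
        exact normVol_pt v
      rw [hVe, ← union_poly]
      exact main_mem _ _ h0 (Finset.singleton_nonempty v) ZR (fun F hF hn _ => hA F hF hn)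
        (fun F hF hn _ => hB F hF hn) (fun F G hF hFn hG hGn _ => ZR_mul (hA F hF hFn) (hB G hG hGn))

theorem normVol_face_int {n : ℕ} {V : Finset (Fin n → ℤ)} (hV : V.Nonempty) {F : Set (Fin n → ℝ)}
    (hF : IsFace (lhull V) F) (hne : F.Nonempty) : normVol F ∈ ZR := by
  obtain ⟨T, hT, hTV, rfl⟩ := face_is_lhull hV hF hne
  exact normVol_int _ T le_rfl hT

/-- even integers -/
def ER : AddSubgroup ℝ where
  carrier := {x | ∃ m : ℤ, x = 2 * (m : ℝ)}
  zero_mem' := ⟨0, by simp⟩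
  add_mem' := by
    rintro _ _ ⟨a, rfl⟩ ⟨b, rfl⟩
    exact ⟨a + b, by push_cast; ring⟩
  neg_mem' := by
    rintro _ ⟨a, rfl⟩
    exact ⟨-a, by push_cast; ring⟩

theorem ER_mul {x y : ℝ} (hx : x ∈ ER) (hy : y ∈ ZR) : x * y ∈ ER := by
  obtain ⟨a, rfl⟩ := hx
  obtain ⟨b, rfl⟩ := hy
  exact ⟨a * b, by simp; ring⟩

theorem normVol_convexHull_union_even {n : ℕ} (k : ℕ) (P Q : Set (Fin n → ℝ))
    (hP : InQclass k P) (hQ : InQclass k Q)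
    (hdim : 2 ^ (k + 1) ≤ polyDim (convexHull ℝ (P ∪ Q))) :
    EvenVol (convexHull ℝ (P ∪ Q)) := by
  obtain ⟨⟨V, hV, rfl⟩, hP⟩ := hP
  obtain ⟨⟨W, hW, rfl⟩, hQ⟩ := hQ
  have h2 : 2 ^ (k + 1) = 2 ^ k + 2 ^ k := by ring
  change normVol (convexHull ℝ (lhull V ∪ lhull W)) ∈ ER
  change _ ≤ polyDim (convexHull ℝ (lhull V ∪ lhull W)) at hdim
  have hP' : ∀ F, IsFace (lhull V) F → 2 ^ k ≤ polyDim F → normVol F ∈ ER := hP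
  have hQ' : ∀ F, IsFace (lhull W) F → 2 ^ k ≤ polyDim F → normVol F ∈ ER := hQ
  refine main_mem V W hV hW ER ?_ ?_ ?_
  · intro F hF _ hd
    exact hP' F hF (by omega)
  · intro F hF _ hd
    exact hQ' F hF (by omega)
  · intro F G hF hFn hG hGn hd
    rcases le_or_gt (2 ^ k) (polyDim F) with h | h
    · exact ER_mul (hP' F hF h) (normVol_face_int hW hG hGn)
    · rw [mul_comm]
      exact ER_mul (hQ' G hG (by omega)) (normVol_face_int hV hF hFn)

end
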